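/- Let X be a topological space with points G_δ (every singleton is the intersection of countably many open sets). If player II has a winning strategy in the game G₁^{ω₁}(𝒦,𝒪) on X, then |X| ≤ 2^{ℵ₀}. -/

import Mathlib

open Cardinal Set

/-- `C` is an open cover of the space `X`: a family of open sets whose union is `X`. -/
def IsOpenCover {X : Type*} [TopologicalSpace X] (C : Set (Set X)) : Prop :=
  (∀ U ∈ C, IsOpen U) ∧ ⋃₀ C = Set.univ

/-- `C` is a `K`-cover of `X`: an open cover such that every compact subset of `X` is
contained in some member of `C`. -/
def IsKCover {X : Type*} [TopologicalSpace X] (C : Set (Set X)) : Prop :=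
  IsOpenCover C ∧ ∀ K : Set X, IsCompact K → ∃ U ∈ C, K ⊆ U

/-- Player II has a winning strategy in the game `G₁^len(𝒦,𝒪)` on `X`. -/
def PlayerIIWinsG1KO (X : Type*) [TopologicalSpace X] (len : Ordinal) : Prop :=
  ∃ F : (ξ : Ordinal) → ξ < len → ((η : Ordinal) → η ≤ ξ → Set (Set X)) → Set X,
    (∀ (ξ : Ordinal) (hξ : ξ < len) (h : (η : Ordinal) → η ≤ ξ → Set (Set X)),
      (∀ η hη, IsKCover (h η hη)) → F ξ hξ h ∈ h ξ le_rfl) ∧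
    (∀ U : Ordinal → Set (Set X), (∀ ξ < len, IsKCover (U ξ)) →
      ⋃₀ {V | ∃ ξ, ∃ hξ : ξ < len, V = F ξ hξ fun η _ => U η} = Set.univ)

/-- `X` has points `G_δ`: every singleton is the intersection of countably many open sets. -/
def PointsGDelta (X : Type*) [TopologicalSpace X] : Prop :=
  ∀ x : X, ∃ 𝒰 : ℕ → Set X, (∀ n, IsOpen (𝒰 n)) ∧ (⋂ n, 𝒰 n) = {x}

/-- A union of at most continuum many sets of size at most continuum has size at most
continuum. -/
theorem mk_iUnion_le_continuum {X : Type*} {ι : Type*} (S : ι → Set X)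
    (hι : #ι ≤ 𝔠) (hS : ∀ i, #(S i) ≤ 𝔠) : #(⋃ i, S i) ≤ 𝔠 := by
  rw [← lift_le, lift_continuum]
  refine (mk_iUnion_le_lift S).trans ?_
  rw [← continuum_mul_self]
  refine mul_le_mul' (lift_le_continuum.2 hι) (ciSup_le' fun i => lift_le_continuum.2 (hS i))

theorem mk_fun_le_continuum (α β : Type*) [Countable α] [Countable β] : #(α → β) ≤ 𝔠 := by
  rw [mk_arrow, ← aleph0_power_aleph0]
  refine (power_le_power_right (lift_le_aleph0.2 mk_le_aleph0)).trans ?_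
  exact power_le_power_left aleph0_ne_zero (lift_le_aleph0.2 mk_le_aleph0)

/-- Closing off under an operation that assigns to countable sets sets of size at most
continuum. -/
theorem exists_closed_under_countable {X : Type*} (Φ : Set X → Set X)
    (hΦ : ∀ C : Set X, C.Countable → #(Φ C) ≤ 𝔠) :
    ∃ A : Set X, #A ≤ 𝔠 ∧ ∀ C ⊆ A, C.Countable → Φ C ⊆ A := by
  cases isEmpty_or_nonempty X
  · exact ⟨∅, by simp, fun C _ _ x => isEmptyElim x⟩
  have he : ∀ C : Set X, ∃ e : ℝ → X, C.Countable → Φ C ⊆ range e := by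
    intro C
    by_cases hC : C.Countable
    · have h : lift.{0} #(Φ C) ≤ lift #ℝ := by simpa [mk_real] using hΦ C hC
      obtain ⟨f⟩ := lift_mk_le'.1 h
      refine ⟨Function.extend f (fun x => (x : X)) fun _ => Classical.arbitrary X, fun _ x hx => ?_⟩
      exact ⟨f ⟨x, hx⟩, f.injective.extend_apply _ _ _⟩
    · exact ⟨fun _ => Classical.arbitrary X, fun h => absurd h hC⟩
  choose e he using he
  let β : Bool × ℝ → Type := fun a => if a.1 then ℕ else Empty
  let ev : WType β → X := WType.elim X fun p => e (range p.2) p.1.2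
  refine ⟨range ev, ?_, fun C hCA hC x hx => ?_⟩
  · have hW : #(WType β) ≤ 𝔠 := by
      refine WType.cardinalMk_le_of_le ?_
      have hle : ∀ a : Bool × ℝ, 𝔠 ^ #(β a) ≤ 𝔠 := by
        rintro ⟨_ | _, r⟩
        · simpa [β] using one_le_aleph0.trans aleph0_le_continuum
        · simp [β]
      refine (sum_le_sum _ _ hle).trans ?_
      simp [mk_real]
    have := mk_range_le_lift (f := ev)
    rw [lift_uzero] at this
    exact this.trans (lift_le_continuum.2 hW)
  · obtain ⟨r, rfl⟩ := he C hC hx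
    rcases C.eq_empty_or_nonempty with rfl | hne
    · have : IsEmpty (β (false, r)) := inferInstanceAs (IsEmpty Empty)
      refine ⟨WType.mk (false, r) isEmptyElim, ?_⟩
      simp [ev, WType.elim, range_eq_empty]
    · obtain ⟨g, rfl⟩ := hC.exists_eq_range hne
      choose t ht using fun n => hCA (mem_range_self n)
      refine ⟨WType.mk (true, r) t, ?_⟩
      change e (range fun n => ev (t n)) r = _
      simp only [ht]

/-- In a compact space with points `G_δ`, every countably compact subset is compact. -/
theorem exists_finite_subcover_of_countable {X : Type*} [TopologicalSpace X] [CompactSpace X]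
    (hGδ : PointsGDelta X) {H : Set X}
    (hH : ∀ 𝒞 : Set (Set X), 𝒞.Countable → (∀ O ∈ 𝒞, IsOpen O) → H ⊆ ⋃₀ 𝒞 →
      ∃ 𝒯 ⊆ 𝒞, 𝒯.Finite ∧ H ⊆ ⋃₀ 𝒯)
    (𝒪 : Set (Set X)) (hO : ∀ O ∈ 𝒪, IsOpen O) (hcov : H ⊆ ⋃₀ 𝒪) :
    ∃ 𝒯 ⊆ 𝒪, 𝒯.Finite ∧ H ⊆ ⋃₀ 𝒯 := by
  by_contra hno
  let S : Set (Set (Set X)) :=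
    {𝒪 | (∀ O ∈ 𝒪, IsOpen O) ∧ ¬ ∃ 𝒯 ⊆ 𝒪, 𝒯.Finite ∧ H ⊆ ⋃₀ 𝒯}
  obtain ⟨ℳ, hOM, ⟨hMo, hMn⟩, hMmax⟩ := zorn_subset_nonempty S (by
    intro c hcS hc hne
    refine ⟨⋃₀ c, ⟨?_, ?_⟩, fun s hs => subset_sUnion_of_mem hs⟩
    · rintro O ⟨s, hs, hOs⟩
      exact (hcS hs).1 O hOs
    · rintro ⟨𝒯, hTc, hTf, hHT⟩
      obtain ⟨s, hs, hTs⟩ :=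
        hc.directedOn.exists_mem_subset_of_finite_of_subset_sUnion hne hTf hTc
      exact (hcS hs).2 ⟨𝒯, hTs, hTf, hHT⟩) 𝒪 ⟨hO, hno⟩
  have hcovM : ⋃₀ ℳ ≠ Set.univ := by
    intro h
    obtain ⟨𝒯, hT, hTf, hc⟩ := isCompact_univ.elim_finite_subcover_image (b := ℳ) (c := id)
      hMo (by simp only [id, ← sUnion_eq_biUnion, h, subset_rfl])
    exact hMn ⟨𝒯, hT, hTf, by rw [sUnion_eq_biUnion]; exact (subset_univ _).trans hc⟩
  obtain ⟨q, hq⟩ := (ne_univ_iff_exists_notMem _).1 hcovM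
  have hqH : q ∉ H := fun h => hq (sUnion_subset_sUnion hOM (hcov h))
  obtain ⟨U, hUo, hUq⟩ := hGδ q
  have hqU : ∀ n, q ∈ U n := fun n => mem_iInter.1 (hUq.symm ▸ mem_singleton q) n
  have key : ∀ n, ∃ 𝒯 ⊆ ℳ, 𝒯.Finite ∧ H ⊆ U n ∪ ⋃₀ 𝒯 := by
    intro n
    have hnot : insert (U n) ℳ ∉ S := fun h =>
      hq ⟨U n, hMmax h (subset_insert _ _) (mem_insert _ _), hqU n⟩
    have : ∃ 𝒯 ⊆ insert (U n) ℳ, 𝒯.Finite ∧ H ⊆ ⋃₀ 𝒯 := by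
      by_contra h
      exact hnot ⟨by rintro O (rfl | hO); exacts [hUo n, hMo O hO], h⟩
    obtain ⟨𝒯, hT, hTf, hHT⟩ := this
    refine ⟨𝒯 \ {U n}, by simpa [sdiff_subset_iff] using hT, hTf.sdiff, fun x hx => ?_⟩
    obtain ⟨O, hO, hxO⟩ := hHT hx
    by_cases hOU : O = U n
    · exact Or.inl (hOU ▸ hxO)
    · exact Or.inr ⟨O, ⟨hO, hOU⟩, hxO⟩
  choose 𝒯 hT hTf hHT using key
  obtain ⟨𝒱, hV, hVf, hHV⟩ := hH (⋃ n, 𝒯 n) (countable_iUnion fun n => (hTf n).countable)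
    (fun O hO => by
      obtain ⟨n, hn⟩ := mem_iUnion.1 hO
      exact hMo O (hT n hn))
    (fun x hx => by
      have hxq : x ∉ ⋂ n, U n := by
        rw [hUq]
        rintro rfl
        exact hqH hx
      obtain ⟨n, hn⟩ := not_forall.1 (mt mem_iInter.2 hxq)
      obtain ⟨O, hO, hxO⟩ := (hHT n hx).resolve_left hn
      exact ⟨O, mem_iUnion.2 ⟨n, hO⟩, hxO⟩)
  exact hMn ⟨𝒱, hV.trans (iUnion_subset hT), hVf, hHV⟩

/-- A set containing a cluster point of each of its sequences is countably compact. -/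
theorem exists_finite_subcover_of_mapClusterPt {X : Type*} [TopologicalSpace X] {H : Set X}
    (hH : ∀ g : ℕ → X, (∀ n, g n ∈ H) → ∃ x ∈ H, MapClusterPt x Filter.atTop g)
    (𝒞 : Set (Set X)) (hC : 𝒞.Countable) (hCo : ∀ O ∈ 𝒞, IsOpen O) (hcov : H ⊆ ⋃₀ 𝒞) :
    ∃ 𝒯 ⊆ 𝒞, 𝒯.Finite ∧ H ⊆ ⋃₀ 𝒯 := by
  rcases 𝒞.eq_empty_or_nonempty with rfl | hne
  · exact ⟨∅, subset_rfl, finite_empty, hcov⟩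
  obtain ⟨O, rfl⟩ := hC.exists_eq_range hne
  by_contra hno
  have hx : ∀ n : ℕ, ∃ x ∈ H, ∀ i ≤ n, x ∉ O i := by
    intro n
    by_contra! h
    refine hno ⟨O '' Iic n, image_subset_range _ _, (finite_Iic n).image _, fun x hx => ?_⟩
    obtain ⟨i, hi, hxi⟩ := h x hx
    exact ⟨O i, mem_image_of_mem _ hi, hxi⟩
  choose g hgH hg using hx
  obtain ⟨x, hxH, hx⟩ := hH g hgH
  obtain ⟨_, ⟨m, rfl⟩, hm⟩ := hcov hxH
  obtain ⟨n, hn, hn'⟩ := (Filter.frequently_atTop.1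
    (hx.frequently ((hCo _ ⟨m, rfl⟩).mem_nhds hm))) m
  exact hg n m hn hn'

theorem exists_notMem_of_iInter_eq_singleton {X : Type*} {U : X → ℕ → Set X}
    (hUx : ∀ x, ⋂ n, U x n = {x}) {A : Set X} {p : X} (hp : p ∉ A) (x : X) :
    ∃ n, x ∈ A → p ∉ U x n := by
  by_cases hx : x ∈ A
  · have : p ∉ ⋂ n, U x n := by
      rw [hUx]
      rintro rfl
      exact hp hx
    obtain ⟨n, hn⟩ := not_forall.1 (mt mem_iInter.2 this)
    exact ⟨n, fun _ => hn⟩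
  · exact ⟨0, fun h => absurd h hx⟩

theorem Finset.exists_image_coe_prod_eq {X ι : Type*} [DecidableEq (X × ι)] {C : Set X}
    (d : Finset (X × ι)) (hd : ∀ a ∈ d, a.1 ∈ C) :
    ∃ σ : Finset (C × ι), σ.image (fun a => ((a.1 : X), a.2)) = d := by
  classical
  refine ⟨d.attach.image fun a => (⟨a.1.1, hd _ a.2⟩, a.1.2), ?_⟩
  ext ⟨x, m⟩
  simpa using fun h => hd (x, m) h

/-- Gryzlov's theorem: a compact space with points `G_δ` has size at most continuum. -/
theorem PointsGDelta.mk_le_continuum_of_compactSpace {X : Type*} [TopologicalSpace X]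
    [CompactSpace X] (hGδ : PointsGDelta X) : #X ≤ 𝔠 := by
  classical
  have hGδ' := hGδ
  choose U hUo hUx using hGδ'
  have hxU : ∀ x n, x ∈ U x n := fun x n => mem_iInter.1 ((hUx x).symm ▸ mem_singleton x) n
  have hcl : ∀ g : ℕ → X, ∃ x, MapClusterPt x Filter.atTop g := fun g =>
    exists_clusterPt_of_compactSpace _
  choose cl hcl using hcl
  let V : Finset (X × ℕ) → Set X := fun d => ⋃ a ∈ d, U a.1 a.2
  let W : (Finset (X × ℕ)) → Set X := fun d => {x | ∃ h : ∃ y, y ∉ V d, x = h.choose}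
  let Φ : Set X → Set X := fun C =>
    (⋃ g : ℕ → C, {cl fun n => g n}) ∪
      ⋃ d : Finset (C × ℕ), W (d.image fun a => ((a.1 : X), a.2))
  obtain ⟨H, hHc, hH⟩ := exists_closed_under_countable Φ (by
    intro C hC
    have := hC.to_subtype
    refine (mk_union_le _ _).trans (add_le_of_le aleph0_le_continuum ?_ ?_)
    · exact mk_iUnion_le_continuum _ (mk_fun_le_continuum _ _) fun g =>
        (mk_singleton _).trans_le (one_le_aleph0.trans aleph0_le_continuum)
    · refine mk_iUnion_le_continuum _ (mk_le_aleph0.trans aleph0_le_continuum) fun d => ?_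
      have : (W (d.image fun a => ((a.1 : X), a.2))).Subsingleton := by
        rintro x ⟨h, rfl⟩ y ⟨_, rfl⟩
        rfl
      exact this.countable.le_aleph0.trans aleph0_le_continuum)
  suffices H = Set.univ by rwa [this, mk_univ] at hHc
  refine eq_univ_of_forall fun p => by_contra fun hp => ?_
  choose n hn using exists_notMem_of_iInter_eq_singleton hUx hp
  obtain ⟨𝒯, hT, hTf, hHT⟩ := exists_finite_subcover_of_countable hGδ
    (exists_finite_subcover_of_mapClusterPt fun g hg => ⟨cl g, hH (range g)
      (range_subset_iff.2 hg) (countable_range g)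
      (Or.inl (mem_iUnion.2 ⟨fun n => ⟨g n, n, rfl⟩, rfl⟩)), hcl g⟩)
    ((fun x => U x (n x)) '' H) (by rintro _ ⟨x, -, rfl⟩; exact hUo _ _)
    (fun x hx => ⟨_, mem_image_of_mem _ hx, hxU x _⟩)
  obtain ⟨t, htH, htf, ht⟩ := (exists_subset_image_finite_and (p := fun 𝒯 => H ⊆ ⋃₀ 𝒯)).1
    ⟨𝒯, hT, hTf, hHT⟩
  let d : Finset (X × ℕ) := htf.toFinset.image fun x => (x, n x)
  have hVd : V d = ⋃₀ ((fun x => U x (n x)) '' t) := by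
    ext y
    simp [V, d]
  have hpd : ∃ y, y ∉ V d := by
    refine ⟨p, ?_⟩
    rw [hVd]
    rintro ⟨_, ⟨x, hx, rfl⟩, hpx⟩
    exact hn x (htH hx) hpx
  have hmem : hpd.choose ∈ H := by
    obtain ⟨σ, hσ⟩ := d.exists_image_coe_prod_eq (C := t) (by simp [d])
    refine hH t htH htf.countable (Or.inr (mem_iUnion.2 ⟨σ, ?_⟩))
    rw [hσ]
    exact ⟨hpd, rfl⟩
  exact hpd.choose_spec (hVd.ge (ht hmem))

/-- The compact set guarding a position: every open set around it can be forced as the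
answer of player II by a suitable `K`-cover. -/
theorem exists_isCompact_forall_response {X : Type*} [TopologicalSpace X] {len : Ordinal}
    {F : (ξ : Ordinal) → ξ < len → ((η : Ordinal) → η ≤ ξ → Set (Set X)) → Set X}
    (hF : ∀ (ξ : Ordinal) (hξ : ξ < len) (h : (η : Ordinal) → η ≤ ξ → Set (Set X)),
      (∀ η hη, IsKCover (h η hη)) → F ξ hξ h ∈ h ξ le_rfl)
    (ξ : Ordinal) (h : (η : Ordinal) → η < ξ → Set (Set X)) :
    ∃ K : Set X, IsCompact K ∧ ∃ R : Set X → Set (Set X),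
      ∀ hξ : ξ < len, (∀ η hη, IsKCover (h η hη)) → ∀ V, IsOpen V → K ⊆ V →
        IsKCover (R V) ∧ F ξ hξ (fun η _ => if hη : η < ξ then h η hη else R V) = V := by
  by_cases hyp : ∃ _ : ξ < len, ∀ η hη, IsKCover (h η hη)
  swap
  · exact ⟨∅, isCompact_empty, fun _ => ∅, fun hξ hh => absurd ⟨hξ, hh⟩ hyp⟩
  obtain ⟨hξ, hh⟩ := hyp
  suffices ∃ K : Set X, IsCompact K ∧ ∀ V, IsOpen V → K ⊆ V → ∃ 𝒰, IsKCover 𝒰 ∧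
      F ξ hξ (fun η _ => if hη : η < ξ then h η hη else 𝒰) = V by
    obtain ⟨K, hK, hV⟩ := this
    choose! R hR using hV
    exact ⟨K, hK, R, fun _ _ => hR⟩
  by_contra! hno
  choose! V hVo hKV hV using hno
  let 𝒰 : Set (Set X) := V '' {K | IsCompact K}
  have h𝒰 : IsKCover 𝒰 := by
    refine ⟨⟨?_, eq_univ_of_forall fun x => ?_⟩, fun K hK => ⟨V K, mem_image_of_mem _ hK, hKV K hK⟩⟩
    · rintro _ ⟨K, hK, rfl⟩
      exact hVo K hK
    · exact ⟨V {x}, mem_image_of_mem _ isCompact_singleton, hKV {x} isCompact_singleton rfl⟩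
  have hmem := hF ξ hξ (fun η _ => if hη : η < ξ then h η hη else 𝒰) (by
    intro η _
    split_ifs with hlt
    exacts [hh η hlt, h𝒰])
  simp only [lt_irrefl, dite_false] at hmem
  obtain ⟨K, hK, hKeq⟩ := hmem
  exact hV K hK 𝒰 h𝒰 hKeq.symm

/-- The transfinite run obtained by feeding the parameters `s` to the rule `R`. -/
def transfiniteRun {𝒞 D : Type*} (R : (ξ : Ordinal) → ((η : Ordinal) → η < ξ → 𝒞) → D → 𝒞)
    (s : Ordinal → D) (ξ : Ordinal) : 𝒞 :=
  R ξ (fun η _ => transfiniteRun R s η) (s ξ)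
termination_by ξ

theorem transfiniteRun_congr {𝒞 D : Type*}
    (R : (ξ : Ordinal) → ((η : Ordinal) → η < ξ → 𝒞) → D → 𝒞) {s t : Ordinal → D}
    (ξ : Ordinal) (hst : ∀ η ≤ ξ, s η = t η) : transfiniteRun R s ξ = transfiniteRun R t ξ := by
  induction ξ using WellFoundedLT.induction with
  | ind ξ ih =>
    rw [transfiniteRun, transfiniteRun, hst ξ le_rfl]
    congr 1
    funext η hη
    exact ih η hη fun ζ hζ => hst ζ (hζ.trans hη.le)

theorem exists_transfiniteRun_parameters {𝒞 D : Type*}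
    (R : (ξ : Ordinal) → ((η : Ordinal) → η < ξ → 𝒞) → D → 𝒞)
    (c : (ξ : Ordinal) → ((η : Ordinal) → η < ξ → 𝒞) → D) :
    ∃ s : Ordinal → D, ∀ ξ, s ξ = c ξ fun η _ => transfiniteRun R s η := by
  let P : Ordinal → 𝒞 := transfiniteRun (fun ξ h (_ : Unit) => R ξ h (c ξ h)) fun _ => ()
  refine ⟨fun ξ => c ξ fun η _ => P η, fun ξ => ?_⟩
  have hP : ∀ ξ, transfiniteRun R (fun ξ => c ξ fun η _ => P η) ξ = P ξ := by
    intro ξ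
    induction ξ using WellFoundedLT.induction with
    | ind ξ ih =>
      rw [transfiniteRun]
      simp only [P]
      rw [transfiniteRun]
      have : (fun η (_ : η < ξ) => transfiniteRun R (fun ξ => c ξ fun η _ => P η) η) =
          fun η _ => P η := by
        funext η hη
        exact ih η hη
      exact congrArg (fun h => R ξ h (c ξ fun η _ => P η)) this
  simp only [hP]

theorem PointsGDelta.subtype {X : Type*} [TopologicalSpace X] (hGδ : PointsGDelta X)
    (K : Set X) : PointsGDelta K := by
  intro x
  obtain ⟨U, hUo, hUx⟩ := hGδ x
  refine ⟨fun n => (↑) ⁻¹' U n, fun n => (hUo n).preimage continuous_subtype_val, ?_⟩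
  rw [← preimage_iInter, hUx]
  ext y
  simp [Subtype.ext_iff]

/-- If `X` has points `G_δ` and player II has a winning strategy in `G₁^{ω₁}(𝒦,𝒪)` on `X`,
then `|X| ≤ 2^{ℵ₀}`. -/
theorem stmt6 {X : Type*} [TopologicalSpace X]
    (hGδ : PointsGDelta X)
    (hwin : PlayerIIWinsG1KO X (Cardinal.aleph 1).ord) :
    #X ≤ Cardinal.continuum := by
  classical
  obtain ⟨F, hF, hwin⟩ := hwin
  have hGδ' := hGδ
  choose U hUo hUx using hGδ'
  have hxU : ∀ x n, x ∈ U x n := fun x n => mem_iInter.1 ((hUx x).symm ▸ mem_singleton x) n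
  let V : Finset (X × ℕ) → Set X := fun d => ⋃ a ∈ d, U a.1 a.2
  have hVo : ∀ d, IsOpen (V d) := fun d => isOpen_biUnion fun a _ => hUo _ _
  choose K hK R hR using exists_isCompact_forall_response hF
  let run := transfiniteRun fun ξ h d => R ξ h (V d)
  let ext : (C : Set X) → (ξ : Ordinal) → (Iio ξ → Finset (C × ℕ)) → Ordinal →
      Finset (X × ℕ) := fun C ξ σ η =>
    if hη : η < ξ then (σ ⟨η, hη⟩).image fun a => ((a.1 : X), a.2) else ∅
  let Φ : Set X → Set X := fun C => ⋃ ξ : Iio (Cardinal.aleph 1).ord,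
    ⋃ σ : Iio ξ.1 → Finset (C × ℕ), K ξ fun η _ => run (ext C ξ σ) η
  have hIio : ∀ ξ < (Cardinal.aleph 1).ord, Countable (Iio ξ) := by
    intro ξ hξ
    rw [← mk_le_aleph0_iff, mk_Iio_ordinal, lift_le_aleph0]
    exact lt_aleph_one_iff.1 (lt_ord.1 hξ)
  obtain ⟨A, hAc, hA⟩ := exists_closed_under_countable Φ (by
    intro C hC
    have := hC.to_subtype
    refine mk_iUnion_le_continuum _ ?_ fun ξ => ?_
    · rw [mk_Iio_ordinal, card_ord, lift_le_continuum]
      exact aleph_one_le_continuum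
    · have := hIio ξ ξ.2
      refine mk_iUnion_le_continuum _ (mk_fun_le_continuum _ _) fun σ => ?_
      have := isCompact_iff_compactSpace.1 (hK ξ fun η _ => run (ext C ξ σ) η)
      exact (hGδ.subtype _).mk_le_continuum_of_compactSpace)
  suffices A = Set.univ by rwa [this, mk_univ] at hAc
  refine eq_univ_of_forall fun p => by_contra fun hp => ?_
  have hpick : ∀ L : Set X, ∃ d : Finset (X × ℕ), IsCompact L → L ⊆ A →
      (∀ a ∈ d, a.1 ∈ A) ∧ L ⊆ V d ∧ p ∉ V d := by
    intro L
    by_cases hL : IsCompact L ∧ L ⊆ A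
    swap
    · exact ⟨∅, fun h h' => absurd ⟨h, h'⟩ hL⟩
    choose n hn using exists_notMem_of_iInter_eq_singleton hUx hp
    obtain ⟨t, htL, ht⟩ := hL.1.elim_nhds_subcover (fun x => U x (n x))
      fun x _ => (hUo _ _).mem_nhds (hxU _ _)
    refine ⟨t.image fun x => (x, n x), fun _ _ => ⟨?_, ?_, ?_⟩⟩
    · intro a ha
      obtain ⟨x, hx, rfl⟩ := Finset.mem_image.1 ha
      exact hL.2 (htL x hx)
    · simpa [V] using ht
    · simpa [V] using fun x hx => hn x (hL.2 (htL x hx))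
  choose pick hpick using hpick
  obtain ⟨s, hs⟩ := exists_transfiniteRun_parameters (fun ξ h d => R ξ h (V d))
    fun ξ h => pick (K ξ h)
  change ∀ ξ, s ξ = pick (K ξ fun η _ => run s η) at hs
  have hrun : ∀ ξ, run s ξ = R ξ (fun η _ => run s η) (V (s ξ)) := fun ξ => by
    simp only [run]
    rw [transfiniteRun]
  have main : ∀ ξ < (Cardinal.aleph 1).ord, IsKCover (run s ξ) ∧
      (K ξ fun η _ => run s η) ⊆ A := by
    intro ξ
    induction ξ using WellFoundedLT.induction with
    | ind ξ ih =>
      intro hξ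
      have hKA : (K ξ fun η _ => run s η) ⊆ A := by
        let C : Set X := ⋃ η : Iio ξ, Prod.fst '' (s η : Set (X × ℕ))
        have hCA : C ⊆ A := by
          refine iUnion_subset fun η => ?_
          rintro _ ⟨a, ha, rfl⟩
          rw [hs] at ha
          exact (hpick _ (hK _ _) (ih η η.2 (lt_trans η.2 hξ)).2).1 a ha
        have hCc : C.Countable := by
          have := hIio ξ hξ
          exact countable_iUnion fun η => ((s η).countable_toSet).image _
        have hσ : ∀ η : Iio ξ, ∃ σ : Finset (C × ℕ),
            σ.image (fun a => ((a.1 : X), a.2)) = s η := fun η =>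
          (s η).exists_image_coe_prod_eq fun a ha => mem_iUnion.2 ⟨η, a, ha, rfl⟩
        choose σ hσ using hσ
        have heq : (fun η (_ : η < ξ) => run s η) = fun η _ => run (ext C ξ σ) η := by
          funext η hη
          refine transfiniteRun_congr _ η fun ζ hζ => ?_
          simp only [ext, hζ.trans_lt hη, dite_true, hσ]
        rw [heq]
        exact fun x hx => hA C hCA hCc (mem_iUnion₂.2 ⟨⟨ξ, hξ⟩, σ, hx⟩)
      refine ⟨?_, hKA⟩
      rw [hrun]
      have := (hpick _ (hK _ _) hKA).2.1
      rw [← hs] at this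
      exact (hR ξ _ hξ (fun η hη => (ih η hη (hη.trans hξ)).1) _ (hVo _) this).1
  have hp' := (hwin (run s) fun ξ hξ => (main ξ hξ).1).symm ▸ mem_univ p
  obtain ⟨_, ⟨ξ, hξ, rfl⟩, hpF⟩ := hp'
  have hd := hpick _ (hK ξ fun η _ => run s η) (main ξ hξ).2
  rw [← hs] at hd
  have hFV := (hR ξ (fun η _ => run s η) hξ (fun η hη => (main η (hη.trans hξ)).1)
    _ (hVo _) hd.2.1).2
  have heq : (fun η (_ : η ≤ ξ) => run s η) = fun η _ =>
      if η < ξ then run s η else R ξ (fun η _ => run s η) (V (s ξ)) := by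
    funext η hη
    split_ifs with h
    · rfl
    · rw [← hrun, hη.antisymm (not_lt.1 h)]
  rw [heq] at hpF
  exact hd.2.2 (hFV ▸ hpF)
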